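/- Let 0 < α < 1, T > 0, λ > 0 and μ > 0. Then 1 − E_{α,1}(−(μ/(1+λ)) T^α) ≥ Γ(1+α)^{−1} / ((1+λ)/(μ T^α) + Γ(1+α)^{−1}), and in particular 1 − E_{α,1}(−(μ/(1+λ)) T^α) > 0. -/

import Mathlib

/-- The Mittag-Leffler function `E_{α,β}(z) = ∑_{m=0}^∞ z^m / Γ(α m + β)`. -/
noncomputable def mittagLeffler (α β z : ℝ) : ℝ :=
  ∑' m : ℕ, z ^ m / Real.Gamma (α * m + β)

open MeasureTheory Set Filter

lemma ml_Gamma_lower (R y : ℝ) (hR : 0 < R) (hy : 1 ≤ y) :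
    R ^ (y - 1) * Real.exp (-R) ≤ Real.Gamma y := by
  have hy0 : 0 < y := by linarith
  rw [Real.Gamma_eq_integral hy0, ← integral_exp_neg_Ioi R, ← integral_const_mul]
  have hI := Real.GammaIntegral_convergent hy0
  have hsub : Ioi R ⊆ Ioi 0 := Ioi_subset_Ioi hR.le
  calc ∫ x in Ioi R, R ^ (y - 1) * Real.exp (-x)
      ≤ ∫ x in Ioi R, Real.exp (-x) * x ^ (y - 1) := by
        apply setIntegral_mono_on
        · exact (integrableOn_exp_neg_Ioi R).const_mul _
        · exact hI.mono_set hsub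
        · exact measurableSet_Ioi
        · intro x hx
          rw [mul_comm]
          gcongr
          exact le_of_lt hx
    _ ≤ _ := by
        apply setIntegral_mono_set hI
        · filter_upwards [ae_restrict_mem measurableSet_Ioi] with x hx
          have : (0:ℝ) < x := hx
          simp only [Pi.zero_apply]
          positivity
        · exact hsub.eventuallyLE

lemma ml_summable (α β z : ℝ) (hα : 0 < α) :
    Summable (fun m : ℕ => |z| ^ m / |Real.Gamma (α * m + β)|) := by
  set B : ℝ := 2 * |z| + 1 with hB
  have hBpos : 0 < B := by positivity
  set R : ℝ := B ^ (1 / α) with hR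
  have hRpos : 0 < R := by positivity
  have hRB : R ^ α = B := by
    rw [hR, ← Real.rpow_mul hBpos.le]; simp [hα.ne']
  have hg : Summable (fun m : ℕ => (Real.exp R * (R ^ (β - 1))⁻¹) * (1 / 2 : ℝ) ^ m) :=
    summable_geometric_two.mul_left _
  apply Summable.of_norm_bounded_eventually_nat hg
  have hev : ∀ᶠ m : ℕ in atTop, (1 - β) / α ≤ m :=
    tendsto_natCast_atTop_atTop.eventually_ge_atTop _
  filter_upwards [hev] with m hm
  have h1 : 1 ≤ α * m + β := by
    rw [div_le_iff₀ hα] at hm; linarith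
  have hG := ml_Gamma_lower R _ hRpos h1
  have hGp : 0 < Real.Gamma (α * m + β) := Real.Gamma_pos_of_pos (by linarith)
  have e1 : R ^ (α * m + β - 1) = B ^ m * R ^ (β - 1) := by
    rw [add_sub_assoc, Real.rpow_add hRpos, Real.rpow_mul hRpos.le, hRB, Real.rpow_natCast]
  rw [e1] at hG
  rw [Real.norm_of_nonneg (by positivity), abs_of_pos hGp]
  have h2 : |z| ^ m ≤ B ^ m * (1 / 2) ^ m := by
    rw [← mul_pow]
    gcongr
    rw [hB]; linarith
  have hR1 : 0 < R ^ (β - 1) := by positivity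
  rw [div_le_iff₀ hGp]
  calc |z| ^ m ≤ B ^ m * (1 / 2) ^ m := h2
    _ = Real.exp R * (R ^ (β - 1))⁻¹ * (1 / 2) ^ m * (B ^ m * R ^ (β - 1) * Real.exp (-R)) := by
        rw [Real.exp_neg]; field_simp
    _ ≤ _ := by gcongr

lemma ml_hasSum (α β z : ℝ) (hα : 0 < α) :
    HasSum (fun m : ℕ => z ^ m / Real.Gamma (α * m + β)) (mittagLeffler α β z) := by
  apply Summable.hasSum
  apply Summable.of_norm
  simpa using ml_summable α β z hα

lemma ml_continuous (α β : ℝ) (hα : 0 < α) : Continuous (mittagLeffler α β) := by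
  rw [continuous_iff_continuousAt]
  intro z
  have : ContinuousOn (mittagLeffler α β) (Icc (-(|z| + 1)) (|z| + 1)) := by
    unfold mittagLeffler
    apply continuousOn_tsum (u := fun m : ℕ => |(|z| + 1)| ^ m / |Real.Gamma (α * m + β)|)
    · intro m; fun_prop
    · exact ml_summable _ _ _ hα
    · intro m x hx
      rw [norm_div, norm_pow, Real.norm_eq_abs, Real.norm_eq_abs]
      have hxz : |x| ≤ |(|z| + 1)| := (abs_le.2 hx).trans (le_abs_self _)
      exact div_le_div_of_nonneg_right (pow_le_pow_left₀ (abs_nonneg x) hxz m) (abs_nonneg _)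
  apply this.continuousAt
  apply Icc_mem_nhds
  · linarith [neg_abs_le z]
  · linarith [le_abs_self z]

/-- Recurrence. -/
lemma ml_rec (α β z : ℝ) (hα : 0 < α) :
    mittagLeffler α β z = (Real.Gamma β)⁻¹ + z * mittagLeffler α (β + α) z := by
  have h := ml_hasSum α β z hα
  have h2 := (ml_hasSum α (β + α) z hα).mul_left z
  have h3 := (hasSum_nat_add_iff' 1).2 h
  have : (fun m : ℕ => z ^ (m + 1) / Real.Gamma (α * ((m + 1 : ℕ) : ℝ) + β)) =
      fun m : ℕ => z * (z ^ m / Real.Gamma (α * m + (β + α))) := by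
    funext m
    push_cast
    rw [show α * ((m : ℝ) + 1) + β = α * m + (β + α) by ring]
    ring
  rw [this] at h3
  have := h3.unique h2
  simp at this
  linarith

lemma ml_beta (a b t : ℝ) (ha : 0 < a) (hb : 0 < b) (ht : 0 < t) :
    ∫ s in Ioc 0 t, s ^ (a - 1) * (t - s) ^ (b - 1) =
      t ^ (a + b - 1) * (Real.Gamma a * Real.Gamma b / Real.Gamma (a + b)) := by
  have h := Complex.betaIntegral_scaled (a : ℂ) b ht
  rw [Complex.betaIntegral_eq_Gamma_mul_div _ _ (by simpa) (by simpa), ← Complex.ofReal_add,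
    Complex.Gamma_ofReal, Complex.Gamma_ofReal, Complex.Gamma_ofReal,
    intervalIntegral.integral_of_le ht.le] at h
  have h' : ∫ x in Ioc 0 t, (x : ℂ) ^ ((a : ℂ) - 1) * ((t : ℂ) - x) ^ ((b : ℂ) - 1) =
      ∫ x in Ioc 0 t, ((x ^ (a - 1) * (t - x) ^ (b - 1) : ℝ) : ℂ) := by
    apply setIntegral_congr_fun measurableSet_Ioc
    intro x hx
    simp only
    push_cast
    rw [Complex.ofReal_cpow hx.1.le, Complex.ofReal_cpow (by linarith [hx.2])]
    push_cast
    rfl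
  rw [h', integral_complex_ofReal] at h
  have h2 : (t : ℂ) ^ (((a + b : ℝ) : ℂ) - 1) = ((t ^ (a + b - 1) : ℝ) : ℂ) := by
    rw [Complex.ofReal_cpow ht.le]; push_cast; rfl
  rw [h2] at h
  exact_mod_cast h

lemma ml_beta_int (a b t : ℝ) (ha : 0 < a) (hb : 0 < b) (ht : 0 < t) :
    IntegrableOn (fun s => s ^ (a - 1) * (t - s) ^ (b - 1)) (Ioc 0 t) := by
  apply Integrable.of_integral_ne_zero
  rw [ml_beta a b t ha hb ht]
  have := Real.Gamma_pos_of_pos ha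
  have := Real.Gamma_pos_of_pos hb
  have := Real.Gamma_pos_of_pos (add_pos ha hb)
  positivity

lemma ml_conv_int (α β γ t : ℝ) (hα : 0 < α) (hβ : 0 < β) (hγ : 0 < γ) (ht : 0 < t) :
    IntegrableOn (fun s => (t - s) ^ (γ - 1) * (s ^ (β - 1) * mittagLeffler α β (-s ^ α)))
      (Ioc 0 t) := by
  have h := ml_beta_int β γ t hβ hγ ht
  rw [← integrableOn_Icc_iff_integrableOn_Ioc] at h ⊢
  have hc : ContinuousOn (fun s : ℝ => mittagLeffler α β (-s ^ α)) (Icc 0 t) := by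
    apply (ml_continuous α β hα).comp_continuousOn
    apply ContinuousOn.neg
    exact (Real.continuous_rpow_const hα.le).continuousOn
  refine (h.mul_continuousOn hc isCompact_Icc).congr_fun ?_ measurableSet_Icc
  intro s _
  simp only
  ring

lemma ml_conv (α β γ t : ℝ) (hα : 0 < α) (hβ : 0 < β) (hγ : 0 < γ) (ht : 0 < t) :
    ∫ s in Ioc 0 t, (t - s) ^ (γ - 1) * (s ^ (β - 1) * mittagLeffler α β (-s ^ α)) =
      Real.Gamma γ * (t ^ (β + γ - 1) * mittagLeffler α (β + γ) (-t ^ α)) := by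
  set F : ℕ → ℝ → ℝ := fun m s =>
    ((-1) ^ m / Real.Gamma (α * m + β)) * (s ^ (α * m + β - 1) * (t - s) ^ (γ - 1)) with hF
  have hp : ∀ m : ℕ, 0 < α * m + β := fun m => by positivity
  have hFi : ∀ m, Integrable (F m) (volume.restrict (Ioc 0 t)) := fun m =>
    (ml_beta_int (α * m + β) γ t (hp m) hγ ht).const_mul _
  have hpow : ∀ (m : ℕ) (s c : ℝ), 0 < s → s ^ (α * m + c) = (s ^ α) ^ m * s ^ c := by
    intro m s c hs
    rw [Real.rpow_add hs, Real.rpow_mul hs.le, Real.rpow_natCast]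
  have hnorm : ∀ m, ∫ s in Ioc 0 t, ‖F m s‖ =
      (Real.Gamma γ * t ^ (β + γ - 1)) * (|t ^ α| ^ m / |Real.Gamma (α * m + (β + γ))|) := by
    intro m
    have hG1 := Real.Gamma_pos_of_pos (hp m)
    have hG2 : 0 < Real.Gamma (α * m + (β + γ)) := Real.Gamma_pos_of_pos (by positivity)
    have : ∫ s in Ioc 0 t, ‖F m s‖ = ∫ s in Ioc 0 t,
        (1 / Real.Gamma (α * m + β)) * (s ^ (α * m + β - 1) * (t - s) ^ (γ - 1)) := by
      apply setIntegral_congr_fun measurableSet_Ioc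
      intro s hs
      have h1 : 0 ≤ s ^ (α * m + β - 1) := Real.rpow_nonneg hs.1.le _
      have h2 : 0 ≤ (t - s) ^ (γ - 1) := Real.rpow_nonneg (by linarith [hs.2]) _
      simp only [hF, norm_mul, norm_div, norm_pow, norm_neg, norm_one, one_pow]
      rw [Real.norm_of_nonneg hG1.le, Real.norm_of_nonneg h1, Real.norm_of_nonneg h2]
    rw [this, integral_const_mul, ml_beta _ _ _ (hp m) hγ ht, abs_of_pos hG2,
      abs_of_pos (by positivity), show α * m + β + γ = α * m + (β + γ) by ring, add_sub_assoc,
      hpow m t _ ht]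
    field_simp
  have hsum : Summable fun m => ∫ s in Ioc 0 t, ‖F m s‖ := by
    simp_rw [hnorm]
    exact (ml_summable _ _ _ hα).mul_left _
  have H := hasSum_integral_of_summable_integral_norm hFi hsum
  have hL : ∫ s in Ioc 0 t, (∑' m, F m s) =
      ∫ s in Ioc 0 t, (t - s) ^ (γ - 1) * (s ^ (β - 1) * mittagLeffler α β (-s ^ α)) := by
    apply setIntegral_congr_fun measurableSet_Ioc
    intro s hs
    simp only
    unfold mittagLeffler
    rw [← tsum_mul_left, ← tsum_mul_left]
    congr 1
    funext m
    simp only [hF]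
    rw [add_sub_assoc, hpow m s _ hs.1, neg_pow (s ^ α)]
    ring
  rw [hL] at H
  have H2 := ((ml_hasSum α (β + γ) (-t ^ α) hα).mul_left
    (Real.Gamma γ * t ^ (β + γ - 1)))
  have hterm : (fun m => ∫ s in Ioc 0 t, F m s) = fun m : ℕ =>
      Real.Gamma γ * t ^ (β + γ - 1) * ((-t ^ α) ^ m / Real.Gamma (α * m + (β + γ))) := by
    funext m
    have hG1 := Real.Gamma_pos_of_pos (hp m)
    have hG2 : 0 < Real.Gamma (α * m + (β + γ)) := Real.Gamma_pos_of_pos (by positivity)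
    simp only [hF]
    rw [integral_const_mul, ml_beta _ _ _ (hp m) hγ ht,
      show α * m + β + γ = α * m + (β + γ) by ring, add_sub_assoc,
      hpow m t _ ht, neg_pow (t ^ α)]
    field_simp
  rw [hterm] at H
  rw [H.unique H2, mul_assoc]

lemma ml_kernel_integral (α t0 t : ℝ) (hα : 0 < α) (h : t ≤ t0) :
    IntegrableOn (fun s => (t0 - s) ^ (α - 1)) (Ioc t t0) ∧
      ∫ s in Ioc t t0, (t0 - s) ^ (α - 1) = (t0 - t) ^ α / α := by
  have h1 : IntervalIntegrable (fun s : ℝ => s ^ (α - 1)) volume 0 (t0 - t) :=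
    intervalIntegral.intervalIntegrable_rpow' (by linarith)
  constructor
  · have h2 := (h1.comp_sub_left t0).symm
    simp only [sub_zero, sub_sub_cancel] at h2
    exact (intervalIntegrable_iff_integrableOn_Ioc_of_le h).1 h2
  · rw [← intervalIntegral.integral_of_le h,
      intervalIntegral.integral_comp_sub_left (fun s : ℝ => s ^ (α - 1)) t0, sub_self,
      integral_rpow (Or.inl (by linarith))]
    simp [hα.ne']

lemma ml_nonneg (α : ℝ) (hα : 0 < α) (hα1 : α < 1) (x : ℝ) (hx : 0 ≤ x) :
    0 ≤ mittagLeffler α α (-x) := by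
  by_contra hneg
  push Not at hneg
  have hcont : Continuous fun y => mittagLeffler α α (-y) :=
    (ml_continuous α α hα).comp continuous_neg
  have hΓ : 0 < Real.Gamma α := Real.Gamma_pos_of_pos hα
  set S : Set ℝ := {y | 0 ≤ y ∧ mittagLeffler α α (-y) ≤ 0} with hS
  have hSc : IsClosed S := (isClosed_le continuous_const continuous_id).inter
    (isClosed_le hcont continuous_const)
  have hSb : BddBelow S := ⟨0, fun y hy => hy.1⟩
  have hSm : sInf S ∈ S := hSc.csInf_mem ⟨x, hx, hneg.le⟩ hSb
  set x0 := sInf S with hx0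
  have hG0 : mittagLeffler α α (-0) = (Real.Gamma α)⁻¹ := by
    rw [ml_rec α α _ hα]; simp
  have hx0pos : 0 < x0 := by
    rcases hSm.1.lt_or_eq with h | h
    · exact h
    · have := hSm.2
      rw [← h, hG0] at this
      have := inv_pos.2 hΓ
      linarith
  have hpos : ∀ y, 0 ≤ y → y < x0 → 0 < mittagLeffler α α (-y) := by
    intro y hy hyx
    by_contra hc
    exact notMem_of_lt_csInf hyx hSb ⟨hy, not_lt.1 hc⟩
  set t0 : ℝ := x0 ^ (1 / α) with ht0
  have ht0p : 0 < t0 := by positivity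
  have ht0x : t0 ^ α = x0 := by
    rw [ht0, ← Real.rpow_mul hx0pos.le]; simp [hα.ne']
  set r : ℝ → ℝ := fun s => s ^ (α - 1) * mittagLeffler α α (-s ^ α) with hr
  have hrpos : ∀ s, 0 < s → s < t0 → 0 < r s := by
    intro s hs hst
    apply mul_pos (by positivity)
    apply hpos _ (by positivity)
    rw [← ht0x]
    exact Real.rpow_lt_rpow hs.le hst hα
  have hr0 : r t0 ≤ 0 := by
    simp only [hr, ht0x]
    exact mul_nonpos_of_nonneg_of_nonpos (by positivity) hSm.2
  have hrc : ContinuousOn r (Ioi 0) := by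
    apply ContinuousOn.mul
    · exact fun s hs => (Real.continuousAt_rpow_const s _ (Or.inl (ne_of_gt hs))).continuousWithinAt
    · exact (hcont.comp (Real.continuous_rpow_const hα.le)).continuousOn
  -- Volterra equation
  have hV : ∀ t, 0 < t → ∫ s in Ioc 0 t, (t - s) ^ (α - 1) * r s =
      t ^ (α - 1) - Real.Gamma α * r t := by
    intro t ht
    rw [ml_conv α α α t hα hα hα ht]
    simp only [hr]
    rw [ml_rec α α (-t ^ α) hα, show α + α - 1 = (α - 1) + α by ring, Real.rpow_add ht]
    field_simp
    ring
  have hVi : ∀ t, 0 < t → IntegrableOn (fun s => (t - s) ^ (α - 1) * r s) (Ioc 0 t) :=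
    fun t ht => ml_conv_int α α α t hα hα hα ht
  -- choose ε
  obtain ⟨ε, hε, hεt, hεa⟩ : ∃ ε : ℝ, 0 < ε ∧ ε ≤ t0 / 2 ∧ ε ^ α / α < Real.Gamma α / 2 := by
    set c : ℝ := α * Real.Gamma α / 4 with hc
    have hcp : 0 < c := by positivity
    refine ⟨min (t0 / 2) (c ^ (1 / α)), by positivity, min_le_left _ _, ?_⟩
    have h1 : (min (t0 / 2) (c ^ (1 / α))) ^ α ≤ c := by
      calc _ ≤ (c ^ (1 / α)) ^ α :=
            Real.rpow_le_rpow (by positivity) (min_le_right _ _) hα.le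
        _ = c := by rw [← Real.rpow_mul hcp.le]; simp [hα.ne']
    rw [div_lt_iff₀ hα]
    have : 0 < α * Real.Gamma α := by positivity
    linarith
  obtain ⟨t, htm, htmax⟩ := (isCompact_Icc (a := t0 - ε) (b := t0)).exists_isMaxOn
    ⟨t0, by constructor <;> linarith⟩ (hrc.mono fun s hs => by
      have := hs.1
      show 0 < s
      linarith)
  have hrt : 0 < r t :=
    lt_of_lt_of_le (hrpos (t0 - ε) (by linarith) (by linarith))
      (htmax ⟨le_refl _, by linarith⟩)
  have htt0 : t < t0 := by
    rcases htm.2.lt_or_eq with h | h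
    · exact h
    · rw [h] at hrt; linarith
  have htp : 0 < t := by linarith [htm.1]
  -- split
  have hint := hVi t0 ht0p
  have hsub1 : Ioc 0 t ⊆ Ioc 0 t0 := Ioc_subset_Ioc_right htt0.le
  have hsub2 : Ioc t t0 ⊆ Ioc 0 t0 := Ioc_subset_Ioc_left htp.le
  have hsplit : ∫ s in Ioc 0 t0, (t0 - s) ^ (α - 1) * r s =
      (∫ s in Ioc 0 t, (t0 - s) ^ (α - 1) * r s) + ∫ s in Ioc t t0, (t0 - s) ^ (α - 1) * r s := by
    rw [← setIntegral_union (Ioc_disjoint_Ioc_of_le le_rfl) measurableSet_Ioc (hint.mono_set hsub1)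
      (hint.mono_set hsub2), Ioc_union_Ioc_eq_Ioc htp.le htt0.le]
  set q : ℝ := (t0 / t) ^ (α - 1) with hq
  have hI1 : ∫ s in Ioc 0 t, (t0 - s) ^ (α - 1) * r s ≤
      q * (t ^ (α - 1) - Real.Gamma α * r t) := by
    rw [← hV t htp, ← integral_const_mul, integral_Ioc_eq_integral_Ioo,
      integral_Ioc_eq_integral_Ioo]
    apply setIntegral_mono_on
    · exact (hint.mono_set hsub1).mono_set Ioo_subset_Ioc_self
    · exact ((hVi t htp).mono_set Ioo_subset_Ioc_self).const_mul _
    · exact measurableSet_Ioo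
    · intro s hs
      have hs1 := hs.1
      have hs2 := hs.2
      rw [← mul_assoc q]
      apply mul_le_mul_of_nonneg_right _ (hrpos s hs1 (by linarith)).le
      rw [hq, ← Real.mul_rpow (by positivity) (by linarith)]
      apply Real.rpow_le_rpow_of_nonpos
      · apply mul_pos (by positivity); linarith
      · rw [div_mul_eq_mul_div, div_le_iff₀ htp]
        nlinarith
      · linarith
  have hI2 : ∫ s in Ioc t t0, (t0 - s) ^ (α - 1) * r s ≤ (t0 - t) ^ α / α * r t := by
    obtain ⟨hk1, hk2⟩ := ml_kernel_integral α t0 t hα htt0.le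
    rw [← hk2, ← integral_mul_const]
    apply setIntegral_mono_on
    · exact hint.mono_set hsub2
    · exact hk1.mul_const _
    · exact measurableSet_Ioc
    · intro s hs
      apply mul_le_mul_of_nonneg_left
      · exact htmax ⟨by linarith [htm.1, hs.1], hs.2⟩
      · exact Real.rpow_nonneg (by linarith [hs.2]) _
  have hqt : q * t ^ (α - 1) = t0 ^ (α - 1) := by
    rw [hq, ← Real.mul_rpow (by positivity) htp.le, div_mul_cancel₀ _ htp.ne']
  have hqhalf : 1 / 2 ≤ q := by
    have h2 : t0 / t ≤ 2 := by
      rw [div_le_iff₀ htp]; linarith [htm.1]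
    have h1 : 1 ≤ t0 / t := by
      rw [le_div_iff₀ htp]; linarith
    calc (1 / 2 : ℝ) ≤ (t0 / t)⁻¹ := by
          rw [one_div]; exact inv_anti₀ (by positivity) h2
      _ = (t0 / t) ^ (-1 : ℝ) := by rw [Real.rpow_neg_one]
      _ ≤ q := Real.rpow_le_rpow_of_exponent_le h1 (by linarith)
  have hpw : (t0 - t) ^ α / α ≤ ε ^ α / α := by
    have h0 : 0 ≤ t0 - t := by linarith
    have h1 : t0 - t ≤ ε := by linarith [htm.1]
    gcongr
  have hfin := hV t0 ht0p
  rw [hsplit] at hfin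
  have hA : q * (Real.Gamma α * r t) ≤ (t0 - t) ^ α / α * r t := by
    have : Real.Gamma α * r t0 ≤ 0 := mul_nonpos_of_nonneg_of_nonpos hΓ.le hr0
    have e : q * (t ^ (α - 1) - Real.Gamma α * r t) = t0 ^ (α - 1) - q * (Real.Gamma α * r t) := by
      rw [mul_sub, hqt]
    linarith
  have hB : 1 / 2 * (Real.Gamma α * r t) ≤ q * (Real.Gamma α * r t) := by
    gcongr
  have hC : (t0 - t) ^ α / α * r t < Real.Gamma α / 2 * r t := by
    exact mul_lt_mul_of_pos_right (by linarith) hrt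
  linarith

lemma ml_eq_one_sub (α t : ℝ) (hα : 0 < α) (ht : 0 < t) :
    IntegrableOn (fun s => s ^ (α - 1) * mittagLeffler α α (-s ^ α)) (Ioc 0 t) ∧
    mittagLeffler α 1 (-t ^ α) =
      1 - ∫ s in Ioc 0 t, s ^ (α - 1) * mittagLeffler α α (-s ^ α) := by
  have h := ml_conv α α 1 t hα hα one_pos ht
  have hi := ml_conv_int α α 1 t hα hα one_pos ht
  simp only [sub_self, Real.rpow_zero, one_mul, Real.Gamma_one, add_sub_cancel_right] at h hi
  refine ⟨hi, ?_⟩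
  rw [h, ml_rec α 1 _ hα, Real.Gamma_one, add_comm 1 α]
  ring

lemma ml_anti (α s t : ℝ) (hα : 0 < α) (hα1 : α < 1) (hs : 0 < s) (hst : s ≤ t) :
    mittagLeffler α 1 (-t ^ α) ≤ mittagLeffler α 1 (-s ^ α) := by
  obtain ⟨hi, h1⟩ := ml_eq_one_sub α t hα (hs.trans_le hst)
  obtain ⟨_, h2⟩ := ml_eq_one_sub α s hα hs
  rw [h1, h2]
  apply sub_le_sub_left
  apply setIntegral_mono_set hi
  · filter_upwards [ae_restrict_mem measurableSet_Ioc] with x hx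
    have hx0 : 0 < x := hx.1
    exact mul_nonneg (by positivity) (ml_nonneg α hα hα1 _ (by positivity))
  · exact (Ioc_subset_Ioc_right hst).eventuallyLE

lemma ml_bound (α t : ℝ) (hα : 0 < α) (hα1 : α < 1) (ht : 0 < t) :
    mittagLeffler α 1 (-t ^ α) * t ^ α ≤
      Real.Gamma (1 + α) * (1 - mittagLeffler α 1 (-t ^ α)) := by
  have h := ml_conv α 1 α t hα one_pos hα ht
  have hi := ml_conv_int α 1 α t hα one_pos hα ht
  simp only [sub_self, Real.rpow_zero, one_mul, add_sub_cancel_left] at h hi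
  obtain ⟨hk1, hk2⟩ := ml_kernel_integral α t 0 hα ht.le
  have hmono : ∫ s in Ioc 0 t, (t - s) ^ (α - 1) * mittagLeffler α 1 (-t ^ α) ≤
      ∫ s in Ioc 0 t, (t - s) ^ (α - 1) * mittagLeffler α 1 (-s ^ α) := by
    apply setIntegral_mono_on (hk1.mul_const _) hi measurableSet_Ioc
    intro s hs
    apply mul_le_mul_of_nonneg_left (ml_anti α s t hα hα1 hs.1 hs.2)
    exact Real.rpow_nonneg (by linarith [hs.2]) _
  rw [integral_mul_const, hk2, h, sub_zero] at hmono
  have hrec := ml_rec α 1 (-t ^ α) hα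
  rw [Real.Gamma_one, inv_one] at hrec
  have e : 1 - mittagLeffler α 1 (-t ^ α) = t ^ α * mittagLeffler α (1 + α) (-t ^ α) := by
    linarith
  rw [e, add_comm 1 α, Real.Gamma_add_one hα.ne', add_comm α 1]
  have := mul_le_mul_of_nonneg_left hmono hα.le
  calc _ = α * (t ^ α / α * mittagLeffler α 1 (-t ^ α)) := by field_simp
    _ ≤ _ := this
    _ = _ := by ring

/-- For `0 < α < 1`, `T > 0`, `λ > 0`, `μ > 0`:
`1 − E_{α,1}(−(μ/(1+λ)) T^α) ≥ Γ(1+α)⁻¹ / ((1+λ)/(μ T^α) + Γ(1+α)⁻¹)`,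
and in particular `1 − E_{α,1}(−(μ/(1+λ)) T^α) > 0`. -/
theorem one_sub_mittagLeffler_lower_bound (α T lam μ : ℝ)
    (hα : 0 < α) (hα1 : α < 1) (hT : 0 < T) (hlam : 0 < lam) (hμ : 0 < μ) :
    (Real.Gamma (1 + α))⁻¹ / ((1 + lam) / (μ * T ^ α) + (Real.Gamma (1 + α))⁻¹) ≤
        1 - mittagLeffler α 1 (-(μ / (1 + lam)) * T ^ α) ∧
      0 < 1 - mittagLeffler α 1 (-(μ / (1 + lam)) * T ^ α) := by
  set x : ℝ := μ / (1 + lam) * T ^ α with hx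
  have hTα : 0 < T ^ α := by positivity
  have hxp : 0 < x := by positivity
  set t : ℝ := x ^ (1 / α) with ht
  have htp : 0 < t := by positivity
  have htx : t ^ α = x := by
    rw [ht, ← Real.rpow_mul hxp.le]; simp [hα.ne']
  have hb := ml_bound α t hα hα1 htp
  rw [htx] at hb
  rw [neg_mul, ← hx]
  have hΓ : 0 < Real.Gamma (1 + α) := Real.Gamma_pos_of_pos (by linarith)
  set G := Real.Gamma (1 + α)
  have e1 : (1 + lam) / (μ * T ^ α) = x⁻¹ := by
    rw [hx]; field_simp
  have e2 : G⁻¹ / ((1 + lam) / (μ * T ^ α) + G⁻¹) = x / (G + x) := by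
    rw [e1]; field_simp
  have h1 : x / (G + x) ≤ 1 - mittagLeffler α 1 (-x) := by
    rw [div_le_iff₀ (by positivity)]
    linarith
  rw [e2]
  exact ⟨h1, lt_of_lt_of_le (by positivity) h1⟩
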